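/- arXiv:math/0403060 — 2 statements merged into one kernel-verified Lean document; each statement's English description precedes it below -/
import Mathlib

section
/- Let ω ∈ Ω₊ be a cookie environment such that the site 0 is ω-transient. Then lim_{K→∞} E_{0,ω}[D_{T_K}^+]/K = 1; that is, the expected drift consumed at nonnegative sites before first reaching K is asymptotically K. -/
open MeasureTheory Filter Set Topology ProbabilityTheory
open scoped ENNReal ENat

noncomputable section

/-- A cookie environment: `ω z i` is the strength of the `(i+1)`-st cookie at site `z`
(cookies at each site are indexed by `i = 0, 1, 2, …`). -/
abbrev CEnv : Type := ℤ → ℕ → ℝ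

/-- `ω` belongs to `Ω₊`, i.e. all cookie strengths lie in `[1/2, 1]`. -/
def IsCookieEnv (ω : CEnv) : Prop := ∀ z i, ω z i ∈ Set.Icc (1/2 : ℝ) 1

/-- The number of visits of the path `x` to the site `x n` at times `m < n`. -/
def prevVisits (x : ℕ → ℤ) (n : ℕ) : ℕ :=
  ((Finset.range n).filter fun m => x m = x n).card

/-- The probability of the step from `x n` to `x (n+1)` for the multi-excited random
walk: jump to the right with the strength of the bottom remaining cookie at the current
site, to the left with the complementary probability. -/
def stepProb (ω : CEnv) (x : ℕ → ℤ) (n : ℕ) : ℝ :=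
  if x (n+1) = x n + 1 then ω (x n) (prevVisits x n)
  else if x (n+1) = x n - 1 then 1 - ω (x n) (prevVisits x n)
  else 0

/-- The probability that the walk started at `x0` follows the path `x` up to time `n`. -/
def cylProb (ω : CEnv) (x0 : ℤ) (x : ℕ → ℤ) (n : ℕ) : ℝ :=
  (if x 0 = x0 then 1 else 0) * ∏ m ∈ Finset.range n, stepProb ω x m

/-- `P` is the law `P_{x0,ω}` of the multi-excited random walk in the cookie
environment `ω` started at `x0`, characterized by its cylinder probabilities. -/
def IsERWLaw (ω : CEnv) (x0 : ℤ) (P : Measure (ℕ → ℤ)) : Prop :=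
  IsProbabilityMeasure P ∧
    ∀ (x : ℕ → ℤ) (n : ℕ),
      P {Y | ∀ m ≤ n, Y m = x m} = ENNReal.ofReal (cylProb ω x0 x n)

/-- First passage time `T_k`, with value `∞` if `k` is never visited. -/
def T (k : ℤ) (Y : ℕ → ℤ) : ℕ∞ :=
  sInf {t : ℕ∞ | ∃ n : ℕ, (n : ℕ∞) = t ∧ Y n = k}

/-- First passage time of an extended-real level, with the convention
`T_{−∞} = T_{+∞} = ∞`. -/
def Te (k : EReal) (Y : ℕ → ℤ) : ℕ∞ :=
  sInf {t : ℕ∞ | ∃ n : ℕ, (n : ℕ∞) = t ∧ ((Y n : ℝ) : EReal) = k}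

/-- `R_k`, the event that the site `k` is visited infinitely often. -/
def Rset (k : ℤ) : Set (ℕ → ℤ) := {Y | ∀ N : ℕ, ∃ n ≥ N, Y n = k}

/-- The number of visits of `Y` to the site `s` at times `< t`. -/
def visitsBefore (Y : ℕ → ℤ) (s : ℤ) (t : ℕ∞) : ℕ∞ :=
  {m : ℕ | (m : ℕ∞) < t ∧ Y m = s}.encard

/-- `D_t^s`: the total drift stored in the cookies consumed at the site `s`
before time `t` (a time in `ℕ∞`; `t = ∞` gives `D_∞^s`). -/
def driftAt (ω : CEnv) (Y : ℕ → ℤ) (s : ℤ) (t : ℕ∞) : ℝ≥0∞ :=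
  ∑' i : ℕ, Set.indicator {i : ℕ | (i : ℕ∞) < visitsBefore Y s t}
    (fun i => ENNReal.ofReal (2 * ω s i - 1)) i

/-- `D_t`: the total drift consumed before time `t` (at all sites). -/
def Dtot (ω : CEnv) (Y : ℕ → ℤ) (t : ℕ∞) : ℝ≥0∞ := ∑' s : ℤ, driftAt ω Y s t

/-- `D_t^+`: the total drift consumed at nonnegative sites before time `t`. -/
def DtotPos (ω : CEnv) (Y : ℕ → ℤ) (t : ℕ∞) : ℝ≥0∞ := ∑' s : ℕ, driftAt ω Y (s : ℤ) t

/-- `δ^s`: the total drift stored in the cookies at the site `s`. -/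
def cookieDrift (ω : CEnv) (s : ℤ) : ℝ≥0∞ := ∑' i : ℕ, ENNReal.ofReal (2 * ω s i - 1)

/-- The successive times `τ_{k,1}, τ_{k,2}, …` (indexed here from `0`) at which the
walk is at a site `≥ k`. -/
def tauT (k : ℤ) (Y : ℕ → ℤ) : ℕ → ℕ∞
  | 0 => sInf {t : ℕ∞ | ∃ n : ℕ, (n : ℕ∞) = t ∧ k ≤ Y n}
  | m + 1 => sInf {t : ℕ∞ | ∃ n : ℕ, (n : ℕ∞) = t ∧ tauT k Y m < (n : ℕ∞) ∧ k ≤ Y n}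

/-- The observed sequence `(X_{τ_{k,m}})_{m ≥ 1}` (indexed here from `0`). -/
def obsSeq (k : ℤ) (Y : ℕ → ℤ) (m : ℕ) : ℤ := Y (tauT k Y m).toNat

/-- The one-sided shift on sequences. -/
def shiftSeq {α : Type*} (u : ℕ → α) : ℕ → α := fun n => u (n + 1)

/-- The restriction `(ω(x))_{x ≥ 0}` of an environment to the nonnegative sites. -/
def restrictNN (ω : CEnv) : ℕ → ℕ → ℝ := fun x => ω (x : ℤ)

/-- `(ω(x))_{x ≥ 0}` is stationary under `Pr`: its law is invariant under the shift. -/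
def IsStationaryEnv (Pr : Measure CEnv) : Prop :=
  MeasurePreserving shiftSeq (Pr.map restrictNN) (Pr.map restrictNN)

/-- `(ω(x))_{x ≥ 0}` is stationary and ergodic under `Pr`. -/
def IsStatErgEnv (Pr : Measure CEnv) : Prop :=
  Ergodic shiftSeq (Pr.map restrictNN)

/-- The process `ξ_k = ((ω(x+k))_{x≥0}, (X_{τ_{k,m}} − k)_{m≥0})` consisting of the
environment to the right of `k` and the trajectory at sites `≥ k`, recentered at `k`. -/
def xiProc (p : CEnv × (ℕ → ℤ)) (k : ℕ) : (ℕ → ℕ → ℝ) × (ℕ → ℤ) :=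
  (fun x : ℕ => p.1 ((x : ℤ) + (k : ℤ)), fun m => obsSeq (k : ℤ) p.2 m - (k : ℤ))

lemma DependsOn.measurable_of_Iic {β : Type*} [MeasurableSpace β] {n : ℕ}
    {G : (ℕ → ℤ) → β} (hG : DependsOn G (Set.Iic n)) : Measurable G := by
  let e : (Fin (n + 1) → ℤ) → ℕ → ℤ := fun c m => if h : m < n + 1 then c ⟨m, h⟩ else 0
  have h : G = (G ∘ e) ∘ fun Y (i : Fin (n + 1)) => Y i := by
    funext Y
    refine hG fun m hm => ?_
    have hm' : m < n + 1 := Nat.lt_succ_of_le hm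
    simp only [e, dif_pos hm']
  rw [h]
  exact (measurable_of_countable _).comp (by fun_prop)

lemma prevVisits_dependsOn (n : ℕ) : DependsOn (fun Y => prevVisits Y n) (Set.Iic n) := by
  intro Y Y' h
  simp only [prevVisits]
  congr 1
  refine Finset.filter_congr fun m hm => ?_
  rw [h m (Finset.mem_range.1 hm).le, h n (Set.mem_Iic.2 le_rfl)]

lemma cylProb_dependsOn (ω : CEnv) (x0 : ℤ) (n : ℕ) :
    DependsOn (fun Y => cylProb ω x0 Y n) (Set.Iic n) := by
  intro Y Y' h
  simp only [cylProb]
  rw [h 0 (Nat.zero_le n)]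
  congr 1
  refine Finset.prod_congr rfl fun m hm => ?_
  have hm' : m < n := Finset.mem_range.1 hm
  have hp : prevVisits Y m = prevVisits Y' m :=
    prevVisits_dependsOn m fun i hi => h i (le_trans (Set.mem_Iic.1 hi) hm'.le)
  simp only [stepProb]
  rw [h m hm'.le, h (m + 1) hm', hp]

/-- The strength of the cookie which the path `Y` consumes at time `n`. -/
def cookieUsed (ω : CEnv) (Y : ℕ → ℤ) (n : ℕ) : ℝ := ω (Y n) (prevVisits Y n)

lemma cookieUsed_mem {ω : CEnv} (hω : IsCookieEnv ω) (Y : ℕ → ℤ) (n : ℕ) :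
    cookieUsed ω Y n ∈ Set.Icc (1 / 2 : ℝ) 1 := hω _ _

lemma cookieUsed_dependsOn (ω : CEnv) (n : ℕ) :
    DependsOn (fun Y => cookieUsed ω Y n) (Set.Iic n) := by
  intro Y Y' h
  have hp : prevVisits Y n = prevVisits Y' n := prevVisits_dependsOn n h
  simp only [cookieUsed]
  rw [h n (Set.mem_Iic.2 le_rfl), hp]

/-- The conditional expectation at time `n` of a functional of the path up to time `n + 1`. -/
def stepMean (ω : CEnv) (n : ℕ) (G : (ℕ → ℤ) → ℝ≥0∞) (Y : ℕ → ℤ) : ℝ≥0∞ :=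
  ENNReal.ofReal (cookieUsed ω Y n) * G (Function.update Y (n + 1) (Y n + 1)) +
    ENNReal.ofReal (1 - cookieUsed ω Y n) * G (Function.update Y (n + 1) (Y n - 1))

/-- One-step Markov-type identity for the walk. -/
lemma IsERWLaw.lintegral_succ {ω : CEnv} (hω : IsCookieEnv ω) {x0 : ℤ}
    {P : Measure (ℕ → ℤ)} (hP : IsERWLaw ω x0 P) {n : ℕ} {G : (ℕ → ℤ) → ℝ≥0∞}
    (hG : DependsOn G (Set.Iic (n + 1))) :
    ∫⁻ Y, G Y ∂P = ∫⁻ Y, stepMean ω n G Y ∂P := by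
  let e : (Fin (n + 1) → ℤ) → ℕ → ℤ := fun c m => if h : m < n + 1 then c ⟨m, h⟩ else 0
  have he : ∀ (c : Fin (n + 1) → ℤ) (m : ℕ) (h : m < n + 1), e c m = c ⟨m, h⟩ := by
    intro c m h; simp only [e, dif_pos h]
  let r : (ℕ → ℤ) → (Fin (n + 1) → ℤ) := fun Y i => Y i
  have hr : Measurable r := by fun_prop
  have her : ∀ Y, ∀ m ≤ n, e (r Y) m = Y m := by
    intro Y m hm; rw [he _ _ (Nat.lt_succ_of_le hm)]
  let r' : (ℕ → ℤ) → (Fin (n + 1) → ℤ) × ℤ := fun Y => (r Y, Y (n + 1))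
  have hr' : Measurable r' := by fun_prop
  have hmean : DependsOn (stepMean ω n G) (Set.Iic n) := by
    intro Y Y' h
    have h1 : cookieUsed ω Y n = cookieUsed ω Y' n := cookieUsed_dependsOn ω n h
    have h2 : ∀ z, G (Function.update Y (n + 1) z) = G (Function.update Y' (n + 1) z) := by
      intro z
      refine hG fun m hm => ?_
      rcases eq_or_ne m (n + 1) with rfl | hne
      · simp
      · rw [Function.update_of_ne hne, Function.update_of_ne hne]
        exact h m (by simp only [Set.mem_Iic] at hm ⊢; omega)
    simp only [stepMean]
    rw [h1, h2, h2, h n (Set.mem_Iic.2 le_rfl)]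
  have hL : ∫⁻ Y, G Y ∂P = ∑' p : (Fin (n + 1) → ℤ) × ℤ,
      G (Function.update (e p.1) (n + 1) p.2) *
        ENNReal.ofReal (cylProb ω x0 (Function.update (e p.1) (n + 1) p.2) (n + 1)) := by
    have h1 : ∫⁻ Y, G Y ∂P =
        ∫⁻ p, G (Function.update (e p.1) (n + 1) p.2) ∂(P.map r') := by
      rw [lintegral_map (measurable_of_countable _) hr']
      refine lintegral_congr fun Y => hG fun m hm => ?_
      rcases eq_or_ne m (n + 1) with rfl | hne
      · simp [r']
      · rw [Function.update_of_ne hne]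
        exact (her Y m (by simp only [Set.mem_Iic] at hm; omega)).symm
    rw [h1, lintegral_countable']
    refine tsum_congr fun p => ?_
    congr 1
    rw [Measure.map_apply hr' (measurableSet_singleton _), ← hP.2]
    congr 1
    ext Y
    simp only [Set.mem_preimage, Set.mem_singleton_iff, Set.mem_ofPred_eq]
    constructor
    · rintro rfl m hm
      rcases eq_or_ne m (n + 1) with rfl | hne
      · simp [r']
      · rw [Function.update_of_ne hne]
        exact (her Y m (by omega)).symm
    · intro h
      refine Prod.ext (funext fun i => ?_) ?_
      · have h1 := h i (by omega)
        rw [Function.update_of_ne (by omega), he _ _ i.2] at h1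
        exact h1
      · have h1 := h (n + 1) le_rfl
        rwa [Function.update_self] at h1
  have hR : ∫⁻ Y, stepMean ω n G Y ∂P = ∑' c : Fin (n + 1) → ℤ,
      stepMean ω n G (e c) * ENNReal.ofReal (cylProb ω x0 (e c) n) := by
    have h1 : ∫⁻ Y, stepMean ω n G Y ∂P = ∫⁻ c, stepMean ω n G (e c) ∂(P.map r) := by
      rw [lintegral_map (measurable_of_countable _) hr]
      exact lintegral_congr fun Y => hmean fun m hm => (her Y m hm).symm
    rw [h1, lintegral_countable']
    refine tsum_congr fun c => ?_
    congr 1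
    rw [Measure.map_apply hr (measurableSet_singleton _), ← hP.2]
    congr 1
    ext Y
    simp only [Set.mem_preimage, Set.mem_singleton_iff, Set.mem_ofPred_eq]
    constructor
    · rintro rfl m hm
      exact (her Y m hm).symm
    · intro h
      funext i
      have h1 := h i (by omega)
      rwa [he _ _ i.2] at h1
  rw [hL, hR, ENNReal.tsum_prod (f := fun c z => G (Function.update (e c) (n + 1) z) *
    ENNReal.ofReal (cylProb ω x0 (Function.update (e c) (n + 1) z) (n + 1)))]
  refine tsum_congr fun c => ?_
  set x := e c
  have hcyl : ∀ z, cylProb ω x0 (Function.update x (n + 1) z) (n + 1) =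
      cylProb ω x0 x n * (if z = x n + 1 then cookieUsed ω x n
        else if z = x n - 1 then 1 - cookieUsed ω x n else 0) := by
    intro z
    have h0 : ∀ m ∈ Set.Iic n, Function.update x (n + 1) z m = x m := by
      intro m hm
      exact Function.update_of_ne (by simp only [Set.mem_Iic] at hm; omega) _ _
    have h1 : cylProb ω x0 (Function.update x (n + 1) z) n = cylProb ω x0 x n :=
      cylProb_dependsOn ω x0 n h0
    have h2 : prevVisits (Function.update x (n + 1) z) n = prevVisits x n :=
      prevVisits_dependsOn n h0
    have h3 : cylProb ω x0 (Function.update x (n + 1) z) (n + 1) =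
        cylProb ω x0 (Function.update x (n + 1) z) n *
          stepProb ω (Function.update x (n + 1) z) n := by
      simp only [cylProb, Finset.prod_range_succ]
      ring
    rw [h3, h1, stepProb, h2, h0 n (Set.mem_Iic.2 le_rfl), Function.update_self]
    rfl
  have hu := cookieUsed_mem hω x n
  have hcyl0 : 0 ≤ cylProb ω x0 x n := by
    refine mul_nonneg (by split_ifs <;> norm_num) (Finset.prod_nonneg fun m _ => ?_)
    have := hω (x m) (prevVisits x m)
    simp only [Set.mem_Icc] at this
    simp only [stepProb]
    split_ifs <;> linarith
  rw [tsum_eq_sum (s := {x n + 1, x n - 1})]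
  · rw [Finset.sum_pair (by omega), hcyl, hcyl, if_pos rfl, if_neg (by omega), if_pos rfl,
      ENNReal.ofReal_mul hcyl0, ENNReal.ofReal_mul hcyl0, stepMean]
    ring
  · intro z hz
    simp only [Finset.mem_insert, Finset.mem_singleton, not_or] at hz
    rw [hcyl, if_neg hz.1, if_neg hz.2]
    simp

lemma IsERWLaw.ae_start {ω : CEnv} {x0 : ℤ} {P : Measure (ℕ → ℤ)} (hP : IsERWLaw ω x0 P) :
    ∀ᵐ Y ∂P, Y 0 = x0 := by
  have := hP.1
  have h := hP.2 (fun _ => x0) 0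
  simp only [cylProb, if_true, Finset.range_zero, Finset.prod_empty, mul_one,
    ENNReal.ofReal_one, Nat.le_zero, forall_eq] at h
  exact (prob_compl_eq_zero_iff
    (measurableSet_eq_fun (measurable_pi_apply 0) measurable_const)).2 h

lemma IsERWLaw.ae_step {ω : CEnv} (hω : IsCookieEnv ω) {x0 : ℤ} {P : Measure (ℕ → ℤ)}
    (hP : IsERWLaw ω x0 P) :
    ∀ᵐ Y ∂P, ∀ n, Y (n + 1) = Y n + 1 ∨ Y (n + 1) = Y n - 1 := by
  refine ae_all_iff.2 fun n => ?_
  classical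
  let G : (ℕ → ℤ) → ℝ≥0∞ := fun Y => if Y (n + 1) = Y n + 1 ∨ Y (n + 1) = Y n - 1 then 0 else 1
  have hG : DependsOn G (Set.Iic (n + 1)) := by
    intro Y Y' h
    simp only [G]
    rw [h n (Set.mem_Iic.2 (by omega)), h (n + 1) (Set.mem_Iic.2 le_rfl)]
  have h0 : ∫⁻ Y, G Y ∂P = 0 := by
    rw [hP.lintegral_succ hω hG]
    simp [stepMean, G]
  rw [lintegral_eq_zero_iff hG.measurable_of_Iic] at h0
  filter_upwards [h0] with Y hY
  by_contra hne
  simp [G, hne] at hY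

/-- The paths which stay strictly below `K` up to time `n`. -/
def belowUpTo (K : ℤ) (n : ℕ) : Set (ℕ → ℤ) := {Y | ∀ m ≤ n, Y m < K}

lemma mem_belowUpTo_congr (K : ℤ) {n : ℕ} {Y Y' : ℕ → ℤ} (h : ∀ i ∈ Set.Iic n, Y i = Y' i) :
    Y ∈ belowUpTo K n ↔ Y' ∈ belowUpTo K n :=
  forall₂_congr fun m hm => by rw [h m hm]

lemma update_mem_belowUpTo {K : ℤ} {n : ℕ} {Y : ℕ → ℤ} {z : ℤ} :
    Function.update Y (n + 1) z ∈ belowUpTo K (n + 1) ↔ Y ∈ belowUpTo K n ∧ z < K := by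
  constructor
  · intro h
    refine ⟨fun m hm => ?_, ?_⟩
    · have := h m (by omega)
      rwa [Function.update_of_ne (by omega)] at this
    · simpa using h (n + 1) le_rfl
  · rintro ⟨h, hz⟩ m hm
    rcases eq_or_ne m (n + 1) with rfl | hne
    · simpa using hz
    · rw [Function.update_of_ne hne]
      exact h m (by omega)

open Classical in
/-- The functional `f` of the walk at time `n`, stopped upon reaching level `K`. -/
def stoppedVal (K : ℤ) (f : ℤ → ℝ) (n : ℕ) (Y : ℕ → ℤ) : ℝ≥0∞ :=
  ENNReal.ofReal (if Y ∈ belowUpTo K n then f (Y n) else f K)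

lemma stoppedVal_dependsOn (K : ℤ) (f : ℤ → ℝ) (n : ℕ) :
    DependsOn (stoppedVal K f n) (Set.Iic n) := by
  intro Y Y' h
  have hm := mem_belowUpTo_congr K h
  by_cases hY : Y ∈ belowUpTo K n
  · simp only [stoppedVal, if_pos hY, if_pos (hm.1 hY), h n (Set.mem_Iic.2 le_rfl)]
  · simp only [stoppedVal, if_neg hY, if_neg (mt hm.2 hY)]

lemma stoppedVal_update_of_mem {K : ℤ} (f : ℤ → ℝ) {n : ℕ} {Y : ℕ → ℤ} {z : ℤ}
    (hY : Y ∈ belowUpTo K n) (hz : z ≤ K) :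
    stoppedVal K f (n + 1) (Function.update Y (n + 1) z) = ENNReal.ofReal (f z) := by
  rcases hz.lt_or_eq with h | rfl
  · simp [stoppedVal, update_mem_belowUpTo, hY, h]
  · simp [stoppedVal, update_mem_belowUpTo]

lemma stoppedVal_update_of_notMem {K : ℤ} (f : ℤ → ℝ) {n : ℕ} {Y : ℕ → ℤ} (z : ℤ)
    (hY : Y ∉ belowUpTo K n) :
    stoppedVal K f (n + 1) (Function.update Y (n + 1) z) = ENNReal.ofReal (f K) := by
  simp [stoppedVal, update_mem_belowUpTo, hY]

lemma stepMean_stoppedVal_of_mem {ω : CEnv} (hω : IsCookieEnv ω) {K : ℤ} {f : ℤ → ℝ}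
    (hf : ∀ z, 0 ≤ f z) {n : ℕ} {Y : ℕ → ℤ} (hY : Y ∈ belowUpTo K n) :
    stepMean ω n (stoppedVal K f (n + 1)) Y = ENNReal.ofReal
      (cookieUsed ω Y n * f (Y n + 1) + (1 - cookieUsed ω Y n) * f (Y n - 1)) := by
  have hu := cookieUsed_mem hω Y n
  have hlt := hY n le_rfl
  have h1 : 0 ≤ cookieUsed ω Y n := by linarith [hu.1]
  have h2 : 0 ≤ 1 - cookieUsed ω Y n := by linarith [hu.2]
  rw [stepMean, stoppedVal_update_of_mem f hY (by omega),
    stoppedVal_update_of_mem f hY (by omega), ENNReal.ofReal_add (mul_nonneg h1 (hf _))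
      (mul_nonneg h2 (hf _)), ENNReal.ofReal_mul h1, ENNReal.ofReal_mul h2]

lemma ofReal_cookieUsed_add {ω : CEnv} (hω : IsCookieEnv ω) (Y : ℕ → ℤ) (n : ℕ) :
    ENNReal.ofReal (cookieUsed ω Y n) + ENNReal.ofReal (1 - cookieUsed ω Y n) = 1 := by
  have hu := cookieUsed_mem hω Y n
  rw [← ENNReal.ofReal_add (by linarith [hu.1]) (by linarith [hu.2])]
  simp

lemma stepMean_stoppedVal_of_notMem {ω : CEnv} (hω : IsCookieEnv ω) {K : ℤ} (f : ℤ → ℝ)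
    {n : ℕ} {Y : ℕ → ℤ} (hY : Y ∉ belowUpTo K n) :
    stepMean ω n (stoppedVal K f (n + 1)) Y = ENNReal.ofReal (f K) := by
  rw [stepMean, stoppedVal_update_of_notMem f _ hY, stoppedVal_update_of_notMem f _ hY,
    ← add_mul, ofReal_cookieUsed_add hω, one_mul]

lemma sum_cookie_pow {K z : ℤ} {u : ℝ} (hu : u ∈ Set.Icc (1 / 2 : ℝ) 1) :
    (2 : ℝ) ^ (z - K) + (2 : ℝ) ^ (z - K) / 4 ≤
      u * (2 : ℝ) ^ (z + 1 - K) + (1 - u) * (2 : ℝ) ^ (z - 1 - K) := by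
  have h : (0 : ℝ) < 2 ^ (z - K) := by positivity
  rw [show z + 1 - K = (z - K) + 1 by ring, show z - 1 - K = (z - K) - 1 by ring,
    zpow_add_one₀ two_ne_zero, zpow_sub_one₀ two_ne_zero]
  nlinarith [hu.1]

lemma indicator_belowUpTo_dependsOn (K : ℤ) (n : ℕ) {g : (ℕ → ℤ) → ℝ≥0∞}
    (hg : DependsOn g (Set.Iic n)) : DependsOn ((belowUpTo K n).indicator g) (Set.Iic n) := by
  intro Y Y' h
  have hm := mem_belowUpTo_congr K h
  by_cases hY : Y ∈ belowUpTo K n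
  · rw [Set.indicator_of_mem hY, Set.indicator_of_mem (hm.1 hY), hg h]
  · rw [Set.indicator_of_notMem hY, Set.indicator_of_notMem (mt hm.2 hY)]

lemma measurableSet_belowUpTo (K : ℤ) (n : ℕ) : MeasurableSet (belowUpTo K n) := by
  have : belowUpTo K n = ⋂ m ∈ Set.Iic n, {Y | Y m < K} := by ext; simp [belowUpTo]
  rw [this]
  exact MeasurableSet.biInter (Set.to_countable _)
    fun m _ => measurableSet_lt (measurable_pi_apply m) measurable_const

/-- The walk reaches every level `K` to the right of its starting point almost surely. -/
lemma IsERWLaw.tendsto_belowUpTo {ω : CEnv} (hω : IsCookieEnv ω) {P : Measure (ℕ → ℤ)}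
    (hP : IsERWLaw ω 0 P) {K : ℤ} (hK : 0 < K) :
    Tendsto (fun n => P (belowUpTo K n)) atTop (𝓝 0) := by
  have := hP.1
  let g : (n : ℕ) → (ℕ → ℤ) → ℝ≥0∞ := fun n => (belowUpTo K n).indicator
    fun Y => ENNReal.ofReal ((2 : ℝ) ^ (Y n - K) / 4)
  have hgd : ∀ n, DependsOn (g n) (Set.Iic n) := fun n =>
    indicator_belowUpTo_dependsOn K n fun Y Y' h => by
      rw [h n (Set.mem_Iic.2 le_rfl)]
  have hsum : ∑' n, ∫⁻ Y, g n Y ∂P ≠ ⊤ := by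
    have hstep : ∀ n, ∑ k ∈ Finset.range n, ∫⁻ Y, g k Y ∂P ≤
        ∫⁻ Y, stoppedVal K (fun z => (2 : ℝ) ^ (z - K)) n Y ∂P := by
      intro n
      induction n with
      | zero => simp
      | succ n ih =>
        rw [Finset.sum_range_succ, hP.lintegral_succ hω (stoppedVal_dependsOn K _ (n + 1))]
        refine (add_le_add_left ih _).trans ?_
        rw [← lintegral_add_right _ (hgd n).measurable_of_Iic]
        refine lintegral_mono fun Y => ?_
        by_cases hY : Y ∈ belowUpTo K n
        · rw [stepMean_stoppedVal_of_mem hω (fun z => by positivity) hY]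
          simp only [stoppedVal, if_pos hY, g, Set.indicator_of_mem hY]
          rw [← ENNReal.ofReal_add (by positivity) (by positivity)]
          exact ENNReal.ofReal_le_ofReal (sum_cookie_pow (cookieUsed_mem hω Y n))
        · rw [stepMean_stoppedVal_of_notMem hω _ hY]
          simp [stoppedVal, hY, g]
    have hbound : ∀ n, ∫⁻ Y, stoppedVal K (fun z => (2 : ℝ) ^ (z - K)) n Y ∂P ≤ 1 := by
      intro n
      calc _ ≤ ∫⁻ _, 1 ∂P := lintegral_mono fun Y => by
            simp only [stoppedVal]
            rw [ENNReal.ofReal_le_one]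
            split_ifs with h
            · exact zpow_le_one_of_nonpos₀ one_le_two (by have := h n le_rfl; omega)
            · simp
        _ = 1 := by simp
    refine ne_top_of_le_ne_top ENNReal.one_ne_top ?_
    exact ENNReal.tsum_le_of_sum_range_le fun n => (hstep n).trans (hbound n)
  have hlin : ∀ n, ∫⁻ Y, stoppedVal K (fun z => max ((K : ℝ) - z) 0) n Y ∂P ≤
      ENNReal.ofReal K := by
    intro n
    induction n with
    | zero =>
      calc _ ≤ ∫⁻ _, ENNReal.ofReal K ∂P := by
            refine lintegral_mono_ae ?_
            filter_upwards [hP.ae_start] with Y hY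
            refine ENNReal.ofReal_le_ofReal ?_
            have : (0 : ℝ) < K := by exact_mod_cast hK
            split_ifs <;> simp [hY, this.le]
        _ = _ := by simp
    | succ n ih =>
      refine le_trans ?_ ih
      rw [hP.lintegral_succ hω (stoppedVal_dependsOn K _ (n + 1))]
      refine lintegral_mono fun Y => ?_
      by_cases hY : Y ∈ belowUpTo K n
      · rw [stepMean_stoppedVal_of_mem hω (fun z => le_max_right _ _) hY]
        simp only [stoppedVal, if_pos hY]
        refine ENNReal.ofReal_le_ofReal ?_
        have hu := cookieUsed_mem hω Y n
        have hlt : (Y n : ℝ) + 1 ≤ K := by exact_mod_cast hY n le_rfl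
        push_cast
        rw [max_eq_left (by linarith), max_eq_left (by linarith), max_eq_left (by linarith)]
        nlinarith [hu.1]
      · rw [stepMean_stoppedVal_of_notMem hω _ hY]
        simp [stoppedVal, hY]
  have hbd : ∀ L : ℕ, 0 < L → ∀ n, P (belowUpTo K n) ≤
      ENNReal.ofReal (4 * 2 ^ L) * ∫⁻ Y, g n Y ∂P + ENNReal.ofReal K / L := by
    intro L hL n
    have hL' : (L : ℝ≥0∞) ≠ 0 := by exact_mod_cast hL.ne'
    rw [← lintegral_indicator_one (measurableSet_belowUpTo K n)]
    calc _ ≤ ∫⁻ Y, (ENNReal.ofReal (4 * 2 ^ L) * g n Y +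
          stoppedVal K (fun z => max ((K : ℝ) - z) 0) n Y / L) ∂P := by
          refine lintegral_mono fun Y => ?_
          by_cases hY : Y ∈ belowUpTo K n
          · simp only [Set.indicator_of_mem hY, stoppedVal, if_pos hY, g, Pi.one_apply]
            rcases le_total (K - Y n) L with h | h
            · refine le_add_right ?_
              rw [← ENNReal.ofReal_mul (by positivity), ENNReal.one_le_ofReal,
                show (4 : ℝ) * 2 ^ L * (2 ^ (Y n - K) / 4) = 2 ^ (L : ℤ) * 2 ^ (Y n - K) by
                  rw [zpow_natCast]; ring, ← zpow_add₀ two_ne_zero]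
              exact one_le_zpow₀ one_le_two (by omega)
            · refine le_add_left ?_
              rw [ENNReal.le_div_iff_mul_le (Or.inl hL') (Or.inl (ENNReal.natCast_ne_top L)),
                one_mul, ← ENNReal.ofReal_natCast]
              refine ENNReal.ofReal_le_ofReal (le_max_of_le_left ?_)
              exact_mod_cast h
          · simp [Set.indicator_of_notMem hY]
      _ ≤ _ := by
          rw [lintegral_add_left ((hgd n).measurable_of_Iic.const_mul _),
            lintegral_const_mul _ (hgd n).measurable_of_Iic]
          simp only [div_eq_mul_inv]
          rw [lintegral_mul_const _ (stoppedVal_dependsOn K _ n).measurable_of_Iic]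
          gcongr
          exact hlin n
  have hg0 := ENNReal.tendsto_atTop_zero_of_tsum_ne_top hsum
  rw [ENNReal.tendsto_nhds_zero]
  intro ε hε
  have hε2 : 0 < ε / 2 := ENNReal.half_pos hε.ne'
  have hdiv : Tendsto (fun L : ℕ => ENNReal.ofReal K / L) atTop (𝓝 0) :=
    ENNReal.Tendsto.const_div ENNReal.tendsto_nat_nhds_top (Or.inr ENNReal.ofReal_ne_top)
      |>.trans (by simp)
  obtain ⟨L, hL, hLpos⟩ := ((ENNReal.tendsto_nhds_zero.1 hdiv _ hε2).and
    (eventually_gt_atTop 0)).exists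
  have hmul : Tendsto (fun n => ENNReal.ofReal (4 * 2 ^ L) * ∫⁻ Y, g n Y ∂P) atTop (𝓝 0) := by
    simpa using ENNReal.Tendsto.const_mul hg0 (Or.inr (ENNReal.ofReal_ne_top (r := 4 * 2 ^ L)))
  filter_upwards [ENNReal.tendsto_nhds_zero.1 hmul _ hε2] with n hn
  calc _ ≤ _ := hbd L hLpos n
    _ ≤ ε / 2 + ε / 2 := add_le_add hn hL
    _ = ε := ENNReal.add_halves ε

lemma image_prevVisits (Y : ℕ → ℤ) (s : ℤ) (t : ℕ∞) :
    (prevVisits Y) '' {n | (n : ℕ∞) < t ∧ Y n = s} =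
      {i : ℕ | (i : ℕ∞) < visitsBefore Y s t} := by
  classical
  let q : ℕ → Prop := fun n => (n : ℕ∞) < t ∧ Y n = s
  have hcount : ∀ n, q n → prevVisits Y n = Nat.count q n := by
    intro n hn
    rw [Nat.count_eq_card_filter_range, prevVisits]
    congr 1
    refine Finset.filter_congr fun m hm => ?_
    have hlt : (m : ℕ∞) < t :=
      lt_trans (Nat.cast_lt.2 (Finset.mem_range.1 hm)) hn.1
    simp [q, hlt, hn.2]
  ext i
  simp only [Set.mem_image, Set.mem_ofPred_eq]
  constructor
  · rintro ⟨n, hn, rfl⟩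
    rw [hcount n hn, visitsBefore]
    have hsub : (((Finset.range (n + 1)).filter q : Finset ℕ) : Set ℕ) ⊆
        {m : ℕ | (m : ℕ∞) < t ∧ Y m = s} := by
      intro m hm
      exact (Finset.mem_filter.1 hm).2
    have hle := Set.encard_le_encard hsub
    rw [Set.encard_coe_eq_coe_finsetCard, ← Nat.count_eq_card_filter_range,
      Nat.count_succ, if_pos hn] at hle
    refine lt_of_lt_of_le ?_ hle
    exact_mod_cast Nat.lt_succ_self _
  · intro hi
    have hfin : ∀ hf : {n | q n}.Finite, i < hf.toFinset.card := by
      intro hf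
      have : visitsBefore Y s t = (hf.toFinset.card : ℕ∞) := hf.encard_eq_coe_toFinset_card
      rw [this] at hi
      exact_mod_cast hi
    have hq : q (Nat.nth q i) := Nat.nth_mem i hfin
    exact ⟨Nat.nth q i, hq, by rw [hcount _ hq, Nat.count_nth hfin]⟩

lemma injOn_prevVisits (Y : ℕ → ℤ) (s : ℤ) : Set.InjOn (prevVisits Y) {n | Y n = s} := by
  classical
  have hcount : ∀ n, Y n = s → prevVisits Y n = Nat.count (fun m => Y m = s) n := by
    intro n hn
    rw [Nat.count_eq_card_filter_range, prevVisits, hn]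
  intro m hm n hn h
  rw [hcount m hm, hcount n hn] at h
  exact Nat.count_injective hm hn h

lemma driftAt_eq_tsum (ω : CEnv) (Y : ℕ → ℤ) (s : ℤ) (t : ℕ∞) :
    driftAt ω Y s t = ∑' n : ℕ, Set.indicator {n : ℕ | (n : ℕ∞) < t ∧ Y n = s}
      (fun n => ENNReal.ofReal (2 * cookieUsed ω Y n - 1)) n := by
  rw [driftAt, ← image_prevVisits, ← tsum_subtype, ← tsum_subtype,
    tsum_image (fun i => ENNReal.ofReal (2 * ω s i - 1))
      ((injOn_prevVisits Y s).mono fun n hn => hn.2)]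
  refine tsum_congr fun n => ?_
  rw [cookieUsed, n.2.2]

lemma DtotPos_eq_tsum (ω : CEnv) (Y : ℕ → ℤ) (t : ℕ∞) :
    DtotPos ω Y t = ∑' n : ℕ, Set.indicator {n : ℕ | (n : ℕ∞) < t ∧ 0 ≤ Y n}
      (fun n => ENNReal.ofReal (2 * cookieUsed ω Y n - 1)) n := by
  simp only [DtotPos, driftAt_eq_tsum]
  rw [ENNReal.tsum_comm]
  refine tsum_congr fun n => ?_
  rw [tsum_eq_single (Y n).toNat]
  · by_cases h : 0 ≤ Y n
    · simp [Set.indicator, h]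
    · have h' : Y n ≠ max (Y n) 0 := by omega
      simp [Set.indicator, h, h']
  · intro b hb
    refine Set.indicator_of_notMem ?_ _
    rintro ⟨-, h⟩
    exact hb (by omega)

lemma coe_lt_T_iff (K : ℤ) (Y : ℕ → ℤ) (n : ℕ) : (n : ℕ∞) < T K Y ↔ ∀ m ≤ n, Y m ≠ K := by
  constructor
  · intro h m hm hY
    have h1 : T K Y ≤ m := sInf_le ⟨m, rfl, hY⟩
    exact absurd (h.trans_le h1) (not_lt.2 (by exact_mod_cast hm))
  · intro h
    have h1 : ((n + 1 : ℕ) : ℕ∞) ≤ T K Y := by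
      refine le_sInf ?_
      rintro _ ⟨m, rfl, hm⟩
      have : n < m := by
        by_contra hle
        exact h m (not_lt.1 hle) hm
      exact_mod_cast this
    exact lt_of_lt_of_le (by exact_mod_cast Nat.lt_succ_self n) h1

lemma coe_lt_T_iff_mem_belowUpTo {K : ℤ} {Y : ℕ → ℤ} (h0 : Y 0 < K)
    (hstep : ∀ n, Y (n + 1) = Y n + 1 ∨ Y (n + 1) = Y n - 1) (n : ℕ) :
    (n : ℕ∞) < T K Y ↔ Y ∈ belowUpTo K n := by
  rw [coe_lt_T_iff]
  constructor
  · intro h m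
    induction m with
    | zero => exact fun _ => h0
    | succ m ih =>
      intro hm
      have h1 := ih (by omega)
      have h2 := h (m + 1) hm
      rcases hstep m with h3 | h3 <;> omega
  · exact fun h m hm => (h m hm).ne

/-- The drift consumed at time `n` at a nonnegative site before reaching level `K`. -/
def posDrift (ω : CEnv) (K : ℤ) (n : ℕ) : (ℕ → ℤ) → ℝ≥0∞ :=
  (belowUpTo K n).indicator fun Y =>
    if 0 ≤ Y n then ENNReal.ofReal (2 * cookieUsed ω Y n - 1) else 0

/-- The indicator of a visit to `0` at time `n` before reaching level `K`. -/
def zeroVisit (K : ℤ) (n : ℕ) : (ℕ → ℤ) → ℝ≥0∞ :=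
  (belowUpTo K n).indicator fun Y => if Y n = 0 then 1 else 0

lemma posDrift_dependsOn (ω : CEnv) (K : ℤ) (n : ℕ) :
    DependsOn (posDrift ω K n) (Set.Iic n) :=
  indicator_belowUpTo_dependsOn K n fun Y Y' h => by
    have hu : cookieUsed ω Y n = cookieUsed ω Y' n := cookieUsed_dependsOn ω n h
    rw [h n (Set.mem_Iic.2 le_rfl), hu]

lemma zeroVisit_dependsOn (K : ℤ) (n : ℕ) : DependsOn (zeroVisit K n) (Set.Iic n) :=
  indicator_belowUpTo_dependsOn K n fun Y Y' h => by
    rw [h n (Set.mem_Iic.2 le_rfl)]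

lemma IsERWLaw.lintegral_DtotPos {ω : CEnv} (hω : IsCookieEnv ω) {P : Measure (ℕ → ℤ)}
    (hP : IsERWLaw ω 0 P) {K : ℤ} (hK : 0 < K) :
    ∫⁻ Y, DtotPos ω Y (T K Y) ∂P = ∑' n, ∫⁻ Y, posDrift ω K n Y ∂P := by
  rw [← lintegral_tsum fun n => (posDrift_dependsOn ω K n).measurable_of_Iic.aemeasurable]
  refine lintegral_congr_ae ?_
  filter_upwards [hP.ae_start, hP.ae_step hω] with Y h0 hstep
  rw [DtotPos_eq_tsum]
  refine tsum_congr fun n => ?_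
  have h := coe_lt_T_iff_mem_belowUpTo (h0.trans_lt hK) hstep n
  by_cases hY : Y ∈ belowUpTo K n
  · simp [posDrift, Set.indicator, h, hY]
  · simp [posDrift, Set.indicator, h, hY]

/-- The one-step means of the stopped positive part of the walk. -/
lemma stepMean_stoppedVal_posPart {ω : CEnv} (hω : IsCookieEnv ω) (K : ℤ) (n : ℕ)
    (Y : ℕ → ℤ) :
    stoppedVal K (fun z => max (z : ℝ) 0) n Y + posDrift ω K n Y ≤
        stepMean ω n (stoppedVal K (fun z => max (z : ℝ) 0) (n + 1)) Y ∧
      stoppedVal K (fun z => max (z : ℝ) 0) n Y + zeroVisit K n Y / 2 ≤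
        stepMean ω n (stoppedVal K (fun z => max (z : ℝ) 0) (n + 1)) Y ∧
      stepMean ω n (stoppedVal K (fun z => max (z : ℝ) 0) (n + 1)) Y ≤
        stoppedVal K (fun z => max (z : ℝ) 0) n Y + (posDrift ω K n Y + zeroVisit K n Y) := by
  by_cases hY : Y ∈ belowUpTo K n
  · rw [stepMean_stoppedVal_of_mem hω (fun z => le_max_right _ _) hY]
    have hu := cookieUsed_mem hω Y n
    simp only [stoppedVal, if_pos hY, posDrift, zeroVisit, Set.indicator_of_mem hY]
    push_cast
    generalize cookieUsed ω Y n = u at hu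
    have hu1 := hu.1
    have hu2 := hu.2
    rcases lt_trichotomy (Y n) 0 with h | h | h
    · have h' : (Y n : ℝ) + 1 ≤ 0 := by exact_mod_cast h
      rw [if_neg (by omega), if_neg (by omega), max_eq_right h', max_eq_right (by linarith),
        max_eq_right (by linarith)]
      simp
    · simp only [h, le_refl, if_true, Int.cast_zero, zero_add, zero_sub, max_self,
        ENNReal.ofReal_zero]
      rw [max_eq_left zero_le_one, max_eq_right (by norm_num)]
      refine ⟨ENNReal.ofReal_le_ofReal (by linarith), ?_, ?_⟩
      · rw [← ENNReal.ofReal_one, ← ENNReal.ofReal_ofNat 2,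
          ← ENNReal.ofReal_div_of_pos two_pos]
        exact ENNReal.ofReal_le_ofReal (by linarith)
      · rw [← ENNReal.ofReal_one, ← ENNReal.ofReal_add (by linarith) zero_le_one]
        exact ENNReal.ofReal_le_ofReal (by linarith)
    · have h' : (1 : ℝ) ≤ Y n := by exact_mod_cast h
      rw [if_pos h.le, if_neg h.ne', max_eq_left (by linarith), max_eq_left (by linarith),
        max_eq_left (by linarith), ENNReal.zero_div, add_zero, add_zero,
        ← ENNReal.ofReal_add (by linarith) (by linarith)]
      refine ⟨ENNReal.ofReal_le_ofReal (by linarith), ENNReal.ofReal_le_ofReal (by nlinarith),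
        ENNReal.ofReal_le_ofReal (by linarith)⟩
  · rw [stepMean_stoppedVal_of_notMem hω _ hY]
    simp [stoppedVal, posDrift, zeroVisit, hY]

lemma stoppedVal_posPart_le {K : ℕ} (n : ℕ) (Y : ℕ → ℤ) :
    stoppedVal K (fun z => max (z : ℝ) 0) n Y ≤ K := by
  rw [stoppedVal, ← ENNReal.ofReal_natCast]
  refine ENNReal.ofReal_le_ofReal ?_
  split_ifs with h
  · have : (Y n : ℝ) ≤ K := by exact_mod_cast (h n le_rfl).le
    exact max_le this (Nat.cast_nonneg K)
  · simp

lemma IsERWLaw.lintegral_stoppedVal_posPart_le {ω : CEnv} {P : Measure (ℕ → ℤ)}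
    (hP : IsERWLaw ω 0 P) {K : ℕ} (n : ℕ) :
    ∫⁻ Y, stoppedVal K (fun z => max (z : ℝ) 0) n Y ∂P ≤ K := by
  have := hP.1
  calc _ ≤ ∫⁻ _, (K : ℝ≥0∞) ∂P := lintegral_mono fun Y => stoppedVal_posPart_le n Y
    _ = K := by simp

/-- The expected drift consumed on the right before `T_K` is at most `K`. -/
lemma IsERWLaw.tsum_posDrift_le {ω : CEnv} (hω : IsCookieEnv ω) {P : Measure (ℕ → ℤ)}
    (hP : IsERWLaw ω 0 P) (K : ℕ) : ∑' n, ∫⁻ Y, posDrift ω K n Y ∂P ≤ K := by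
  refine ENNReal.tsum_le_of_sum_range_le fun n => ?_
  refine le_trans ?_ (hP.lintegral_stoppedVal_posPart_le n)
  induction n with
  | zero => simp
  | succ n ih =>
    rw [Finset.sum_range_succ, hP.lintegral_succ hω (stoppedVal_dependsOn _ _ (n + 1))]
    refine (add_le_add_left ih _).trans ?_
    rw [← lintegral_add_right _ (posDrift_dependsOn ω K n).measurable_of_Iic]
    exact lintegral_mono fun Y => (stepMean_stoppedVal_posPart hω K n Y).1

/-- `K` is at most the expected drift consumed on the right before `T_K` plus the expected
number of visits to `0` before `T_K`. -/
lemma IsERWLaw.le_tsum_posDrift_add {ω : CEnv} (hω : IsCookieEnv ω) {P : Measure (ℕ → ℤ)}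
    (hP : IsERWLaw ω 0 P) {K : ℕ} (hK : 0 < K) :
    (K : ℝ≥0∞) ≤ ∑' n, ∫⁻ Y, posDrift ω K n Y ∂P + ∑' n, ∫⁻ Y, zeroVisit K n Y ∂P := by
  have := hP.1
  have hK' : (0 : ℤ) < K := by exact_mod_cast hK
  have hup : ∀ n, ∫⁻ Y, stoppedVal K (fun z => max (z : ℝ) 0) n Y ∂P ≤
      ∑ k ∈ Finset.range n, (∫⁻ Y, posDrift ω K k Y ∂P + ∫⁻ Y, zeroVisit K k Y ∂P) := by
    intro n
    induction n with
    | zero =>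
      simp only [Finset.range_zero, Finset.sum_empty, nonpos_iff_eq_zero]
      rw [lintegral_eq_zero_iff (stoppedVal_dependsOn _ _ 0).measurable_of_Iic]
      filter_upwards [hP.ae_start] with Y h0
      have hY : Y ∈ belowUpTo K 0 := by
        intro m hm
        rw [Nat.le_zero.1 hm, h0]
        exact hK'
      simp [stoppedVal, hY, h0]
    | succ n ih =>
      rw [Finset.sum_range_succ, hP.lintegral_succ hω (stoppedVal_dependsOn _ _ (n + 1))]
      refine le_trans ?_ (add_le_add_left ih _)
      rw [← lintegral_add_left (posDrift_dependsOn ω K n).measurable_of_Iic,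
        ← lintegral_add_left (stoppedVal_dependsOn _ _ n).measurable_of_Iic]
      exact lintegral_mono fun Y => (stepMean_stoppedVal_posPart hω K n Y).2.2
  have hlow : ∀ n, (K : ℝ≥0∞) ≤ ∫⁻ Y, stoppedVal K (fun z => max (z : ℝ) 0) n Y ∂P +
      K * P (belowUpTo K n) := by
    intro n
    have hm := measurableSet_belowUpTo K n
    calc (K : ℝ≥0∞) = ∫⁻ _, (K : ℝ≥0∞) ∂P := by simp
      _ ≤ ∫⁻ Y, (stoppedVal K (fun z => max (z : ℝ) 0) n Y +
          (belowUpTo (K : ℤ) n).indicator (fun _ => (K : ℝ≥0∞)) Y) ∂P := by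
        refine lintegral_mono fun Y => ?_
        by_cases hY : Y ∈ belowUpTo K n
        · simp [Set.indicator_of_mem hY]
        · simp [stoppedVal, hY]
      _ = _ := by
        rw [lintegral_add_left (stoppedVal_dependsOn _ _ n).measurable_of_Iic,
          lintegral_indicator_const hm]
  have hlim : Tendsto (fun n => (∑' n, ∫⁻ Y, posDrift ω K n Y ∂P +
      ∑' n, ∫⁻ Y, zeroVisit K n Y ∂P) + K * P (belowUpTo K n)) atTop
      (𝓝 ((∑' n, ∫⁻ Y, posDrift ω K n Y ∂P + ∑' n, ∫⁻ Y, zeroVisit K n Y ∂P) + K * 0)) :=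
    (ENNReal.Tendsto.const_mul (hP.tendsto_belowUpTo hω hK')
      (Or.inr (ENNReal.natCast_ne_top K))).const_add _
  rw [mul_zero, add_zero] at hlim
  refine ge_of_tendsto' hlim fun n => (hlow n).trans ?_
  gcongr
  refine (hup n).trans ?_
  rw [← ENNReal.tsum_add]
  exact ENNReal.sum_le_tsum _

/-- The expected number of visits to `0` before `T_K` is controlled by the probability of
visiting `0` after a fixed time. -/
lemma IsERWLaw.tsum_zeroVisit_le {ω : CEnv} (hω : IsCookieEnv ω) {P : Measure (ℕ → ℤ)}
    (hP : IsERWLaw ω 0 P) (K N : ℕ) :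
    ∑' n, ∫⁻ Y, zeroVisit K n Y ∂P ≤ N + 2 * (K * P {Y | ∃ n ≥ N, Y n = 0}) := by
  classical
  have := hP.1
  have hB : MeasurableSet {Y : ℕ → ℤ | ∃ n ≥ N, Y n = 0} := by
    have : {Y : ℕ → ℤ | ∃ n ≥ N, Y n = 0} = ⋃ n ∈ Set.Ici N, {Y | Y n = 0} := by
      ext; simp
    rw [this]
    exact MeasurableSet.biUnion (Set.to_countable _)
      fun m _ => measurableSet_eq_fun (measurable_pi_apply m) measurable_const
  let Z : (n : ℕ) → (ℕ → ℤ) → ℝ≥0∞ := fun n Y =>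
    if ∃ m, N ≤ m ∧ m ≤ n ∧ Y m = 0 then stoppedVal K (fun z => max (z : ℝ) 0) n Y else 0
  have hZ : ∀ n, DependsOn (Z n) (Set.Iic n) := by
    intro n Y Y' h
    have h1 : (∃ m, N ≤ m ∧ m ≤ n ∧ Y m = 0) ↔ ∃ m, N ≤ m ∧ m ≤ n ∧ Y' m = 0 :=
      exists_congr fun m => and_congr_right fun _ => and_congr_right fun hm => by
        rw [h m (Set.mem_Iic.2 hm)]
    have h2 := stoppedVal_dependsOn K (fun z => max (z : ℝ) 0) n h
    simp only [Z, h1, h2]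
  have hstep : ∀ n, N ≤ n → ∀ Y, Z n Y + zeroVisit K n Y / 2 ≤ stepMean ω n (Z (n + 1)) Y := by
    intro n hn Y
    by_cases hY : ∃ m, N ≤ m ∧ m ≤ n ∧ Y m = 0
    · have h1 : ∀ z, Z (n + 1) (Function.update Y (n + 1) z) =
          stoppedVal K (fun z => max (z : ℝ) 0) (n + 1) (Function.update Y (n + 1) z) := by
        intro z
        obtain ⟨m, hm, hmn, h0⟩ := hY
        refine if_pos ⟨m, hm, by omega, ?_⟩
        rwa [Function.update_of_ne (by omega)]
      have h2 := (stepMean_stoppedVal_posPart hω K n Y).2.1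
      simp only [stepMean] at h2 ⊢
      simpa only [h1, Z, if_pos hY] using h2
    · have h1 : Y n ≠ 0 := fun h => hY ⟨n, hn, le_rfl, h⟩
      simp [Z, hY, zeroVisit, Set.indicator, h1]
  have hsum : ∀ n, ∑ k ∈ Finset.range n, (∫⁻ Y, zeroVisit K (k + N) Y ∂P) / 2 ≤
      ∫⁻ Y, Z (n + N) Y ∂P := by
    intro n
    induction n with
    | zero => simp
    | succ n ih =>
      rw [Finset.sum_range_succ, show n + 1 + N = n + N + 1 by ring,
        hP.lintegral_succ hω (hZ (n + N + 1))]
      refine (add_le_add_left ih _).trans ?_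
      rw [div_eq_mul_inv, ← lintegral_mul_const _ (zeroVisit_dependsOn K _).measurable_of_Iic,
        ← lintegral_add_left (hZ (n + N)).measurable_of_Iic]
      exact lintegral_mono fun Y => hstep (n + N) (by omega) Y
  have hZle : ∀ n, ∫⁻ Y, Z n Y ∂P ≤ K * P {Y | ∃ n ≥ N, Y n = 0} := by
    intro n
    rw [← lintegral_indicator_const hB]
    refine lintegral_mono fun Y => ?_
    by_cases hY : ∃ m, N ≤ m ∧ m ≤ n ∧ Y m = 0
    · obtain ⟨m, hm, -, h0⟩ := id hY
      have hmem : Y ∈ {Y : ℕ → ℤ | ∃ n ≥ N, Y n = 0} := ⟨m, hm, h0⟩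
      simp only [Z, if_pos hY, Set.indicator_of_mem hmem]
      exact stoppedVal_posPart_le n Y
    · simp [Z, hY]
  have hone : ∀ n, ∫⁻ Y, zeroVisit K n Y ∂P ≤ 1 := by
    intro n
    calc _ ≤ ∫⁻ _, 1 ∂P := lintegral_mono fun Y => by
          refine Set.indicator_apply_le' (fun _ => ?_) fun _ => zero_le_one
          split_ifs <;> simp
      _ = 1 := by simp
  rw [← ENNReal.summable.sum_add_tsum_nat_add' (k := N)]
  gcongr
  · calc _ ≤ ∑ _k ∈ Finset.range N, (1 : ℝ≥0∞) := Finset.sum_le_sum fun n _ => hone n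
      _ = N := by simp
  · have h : (∑' n, ∫⁻ Y, zeroVisit K (n + N) Y ∂P) / 2 ≤
        K * P {Y | ∃ n ≥ N, Y n = 0} := by
      rw [div_eq_mul_inv, ← ENNReal.tsum_mul_right]
      exact ENNReal.tsum_le_of_sum_range_le fun n => (hsum n).trans (hZle _)
    rwa [ENNReal.div_le_iff (by norm_num) (by norm_num), mul_comm] at h

lemma tendsto_measure_visit_after (P : Measure (ℕ → ℤ)) [IsFiniteMeasure P]
    (h : P (Rset 0) = 0) :
    Tendsto (fun N : ℕ => P {Y | ∃ n ≥ N, Y n = 0}) atTop (𝓝 0) := by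
  have hR : Rset 0 = ⋂ N : ℕ, {Y : ℕ → ℤ | ∃ n ≥ N, Y n = 0} := by
    ext; simp [Rset]
  rw [← h, hR]
  refine tendsto_measure_iInter_atTop (fun N => ?_) ?_ ⟨0, measure_ne_top _ _⟩
  · have : {Y : ℕ → ℤ | ∃ n ≥ N, Y n = 0} = ⋃ n ∈ Set.Ici N, {Y | Y n = 0} := by
      ext; simp
    rw [this]
    exact (MeasurableSet.biUnion (Set.to_countable _)
      fun m _ => measurableSet_eq_fun (measurable_pi_apply m)
        measurable_const).nullMeasurableSet
  · rintro M N hMN Y ⟨n, hn, h0⟩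
    exact ⟨n, le_trans hMN hn, h0⟩

/-- Lemma 8. If `0` is `ω`-transient then
`E_{0,ω}[D_{T_K}^+]/K → 1` as `K → ∞`. -/
theorem erw_drift_right_asymptotics (ω : CEnv) (hω : IsCookieEnv ω)
    (P : ℤ → Measure (ℕ → ℤ)) (hP : ∀ x, IsERWLaw ω x (P x))
    (htrans : ∀ x, P x (Rset 0) = 0) :
    Tendsto (fun K : ℕ => (∫⁻ Y, DtotPos ω Y (T (K : ℤ) Y) ∂(P 0)) / (K : ℝ≥0∞))
      atTop (𝓝 1) := by
  have := (hP 0).1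
  have hev : ∀ᶠ K : ℕ in atTop, (∫⁻ Y, DtotPos ω Y (T (K : ℤ) Y) ∂(P 0)) =
      ∑' n, ∫⁻ Y, posDrift ω K n Y ∂(P 0) := by
    filter_upwards [eventually_gt_atTop 0] with K hK
    exact (hP 0).lintegral_DtotPos hω (by exact_mod_cast hK)
  rw [tendsto_order]
  constructor
  · intro a ha
    obtain ⟨b, hab, hb⟩ := exists_between ha
    have hε : 0 < (1 - b) / 2 := ENNReal.half_pos (tsub_pos_of_lt hb).ne'
    have hq : Tendsto (fun N : ℕ => 2 * P 0 {Y | ∃ n ≥ N, Y n = 0}) atTop (𝓝 0) := by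
      simpa using ENNReal.Tendsto.const_mul
        (tendsto_measure_visit_after (P 0) (htrans 0)) (Or.inr (ENNReal.ofNat_ne_top (n := 2)))
    obtain ⟨N, hN⟩ := (ENNReal.tendsto_nhds_zero.1 hq _ hε).exists
    have hdiv : Tendsto (fun K : ℕ => (N : ℝ≥0∞) / K) atTop (𝓝 0) :=
      ENNReal.Tendsto.const_div ENNReal.tendsto_nat_nhds_top
        (Or.inr (ENNReal.natCast_ne_top N)) |>.trans (by simp)
    filter_upwards [hev, ENNReal.tendsto_nhds_zero.1 hdiv _ hε, eventually_gt_atTop 0]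
      with K hK hNK hpos
    rw [hK]
    have hK0 : (K : ℝ≥0∞) ≠ 0 := by exact_mod_cast hpos.ne'
    have hKt : (K : ℝ≥0∞) ≠ ⊤ := ENNReal.natCast_ne_top K
    set E := ∑' n, ∫⁻ Y, posDrift ω K n Y ∂(P 0)
    have h1 : (K : ℝ≥0∞) ≤ E + (N + 2 * (K * P 0 {Y | ∃ n ≥ N, Y n = 0})) :=
      ((hP 0).le_tsum_posDrift_add hω hpos).trans
        (add_le_add_right ((hP 0).tsum_zeroVisit_le hω K N) _)
    have h2 : 1 ≤ E / K + (1 - b) := by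
      calc (1 : ℝ≥0∞) = K / K := (ENNReal.div_self hK0 hKt).symm
        _ ≤ (E + (N + 2 * (K * P 0 {Y | ∃ n ≥ N, Y n = 0}))) / K := by gcongr
        _ = E / K + (N / K + 2 * P 0 {Y | ∃ n ≥ N, Y n = 0}) := by
          rw [ENNReal.add_div, ENNReal.add_div, mul_left_comm, ENNReal.mul_div_right_comm,
            ENNReal.div_self hK0 hKt, one_mul]
        _ ≤ E / K + ((1 - b) / 2 + (1 - b) / 2) := by gcongr
        _ = E / K + (1 - b) := by rw [ENNReal.add_halves]
    have h3 : b + (1 - b) ≤ E / K + (1 - b) := by rwa [add_tsub_cancel_of_le hb.le]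
    exact hab.trans_le (ENNReal.le_of_add_le_add_right
      (ne_top_of_le_ne_top ENNReal.one_ne_top tsub_le_self) h3)
  · intro a ha
    filter_upwards [hev] with K hK
    rw [hK]
    refine lt_of_le_of_lt (ENNReal.div_le_of_le_mul ?_) ha
    rw [one_mul]
    exact (hP 0).tsum_posDrift_le hω K

end
end

section
/- Let ω ∈ Ω₊ be a cookie environment with liminf_{K→∞} (1/K) Σ_{x=0}^{K−1} δ^x(ω) < 1, where δ^x(ω) := Σ_{i≥1} (2ω(x,i) − 1). Then the site 0 is ω-recurrent. -/
open MeasureTheory Filter Set Topology ProbabilityTheory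
open scoped ENNReal ENat

noncomputable section

/-- The paths agreeing with `x` up to time `n`. -/
def pathCylinder (x : ℕ → ℤ) (n : ℕ) : Set (ℕ → ℤ) := {Y | ∀ m ≤ n, Y m = x m}

/-- The number of visits of the path `x` to the site `s` at times `m < n`. -/
def visitCount (x : ℕ → ℤ) (n : ℕ) (s : ℤ) : ℕ :=
  ((Finset.range n).filter fun m => x m = s).card

lemma visitCount_update (x : ℕ → ℤ) (n : ℕ) (z s : ℤ) :
    visitCount (Function.update x (n + 1) z) (n + 1) s
      = visitCount x n s + if x n = s then 1 else 0 := by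
  have h : (Finset.range (n + 1)).filter (fun m => Function.update x (n + 1) z m = s)
      = (Finset.range (n + 1)).filter (fun m => x m = s) := by
    refine Finset.filter_congr fun m hm => ?_
    rw [Function.update_of_ne (Finset.mem_range.1 hm).ne]
  rw [visitCount, h, visitCount, Finset.range_add_one, Finset.filter_insert]
  split_ifs <;> simp

lemma prevVisits_congr {x y : ℕ → ℤ} {n : ℕ} (h : ∀ m ≤ n, x m = y m) :
    prevVisits x n = prevVisits y n := by
  unfold prevVisits
  congr 1
  refine Finset.filter_congr fun m hm => ?_
  rw [h m (Finset.mem_range.1 hm).le, h n le_rfl]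

lemma cylProb_update (ω : CEnv) (x0 : ℤ) (x : ℕ → ℤ) (n : ℕ) (z : ℤ) :
    cylProb ω x0 (Function.update x (n + 1) z) (n + 1)
      = cylProb ω x0 x n * stepProb ω (Function.update x (n + 1) z) n := by
  have hu : ∀ m ≤ n, Function.update x (n + 1) z m = x m := fun m hm =>
    Function.update_of_ne (by omega) _ _
  unfold cylProb
  rw [Finset.prod_range_succ, hu 0 (Nat.zero_le n), mul_assoc]
  congr 2
  refine Finset.prod_congr rfl fun m hm => ?_
  have hm' := Finset.mem_range.1 hm
  unfold stepProb
  rw [hu m hm'.le, hu (m + 1) hm', prevVisits_congr fun k hk => hu k (hk.trans hm'.le)]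

lemma stepProb_update (ω : CEnv) (x : ℕ → ℤ) (n : ℕ) (z : ℤ) :
    stepProb ω (Function.update x (n + 1) z) n
      = if z = x n + 1 then ω (x n) (prevVisits x n)
        else if z = x n - 1 then 1 - ω (x n) (prevVisits x n) else 0 := by
  have hu : ∀ m ≤ n, Function.update x (n + 1) z m = x m := fun m hm =>
    Function.update_of_ne (by omega) _ _
  rw [stepProb, prevVisits_congr hu, hu n le_rfl, Function.update_self]

lemma stepProb_nonneg {ω : CEnv} (hω : IsCookieEnv ω) (x : ℕ → ℤ) (n : ℕ) :
    0 ≤ stepProb ω x n := by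
  have := hω (x n) (prevVisits x n)
  unfold stepProb
  split_ifs <;> linarith [this.1, this.2]

lemma cylProb_nonneg {ω : CEnv} (hω : IsCookieEnv ω) (x0 : ℤ) (x : ℕ → ℤ) (n : ℕ) :
    0 ≤ cylProb ω x0 x n :=
  mul_nonneg (by split_ifs <;> norm_num)
    (Finset.prod_nonneg fun m _ => stepProb_nonneg hω x m)

namespace IsERWLaw

variable {ω : CEnv} {x0 : ℤ} {P : Measure (ℕ → ℤ)}

lemma real_pathCylinder (hP : IsERWLaw ω x0 P) (hω : IsCookieEnv ω) (x : ℕ → ℤ) (n : ℕ) :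
    P.real (pathCylinder x n) = cylProb ω x0 x n := by
  rw [Measure.real, pathCylinder, hP.2 x n, ENNReal.toReal_ofReal (cylProb_nonneg hω x0 x n)]

/-- The walk makes nearest-neighbour steps, so the mass of a cylinder is carried by its two
nearest-neighbour extensions. -/
lemma real_pathCylinder_inter_le (hP : IsERWLaw ω x0 P) (x : ℕ → ℤ) (n : ℕ)
    (E : Set (ℕ → ℤ)) :
    P.real (pathCylinder x n ∩ E)
      ≤ P.real (pathCylinder (Function.update x (n + 1) (x n + 1)) (n + 1) ∩ E)
        + P.real (pathCylinder (Function.update x (n + 1) (x n - 1)) (n + 1) ∩ E) := by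
  have := hP.1
  set N : Set (ℕ → ℤ) := ⋃ z : {z : ℤ // z ≠ x n + 1 ∧ z ≠ x n - 1},
    pathCylinder (Function.update x (n + 1) z) (n + 1)
  have hN : P N = 0 := by
    refine measure_iUnion_null fun z => ?_
    rw [pathCylinder, hP.2, cylProb_update, stepProb_update, if_neg z.2.1, if_neg z.2.2]
    simp
  have hsub : pathCylinder x n ∩ E
      ⊆ (pathCylinder (Function.update x (n + 1) (x n + 1)) (n + 1) ∩ E
        ∪ pathCylinder (Function.update x (n + 1) (x n - 1)) (n + 1) ∩ E) ∪ N := by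
    rintro Y ⟨hY, hE⟩
    have key : Y ∈ pathCylinder (Function.update x (n + 1) (Y (n + 1))) (n + 1) := by
      intro m hm
      rcases hm.eq_or_lt with rfl | hm
      · simp
      · rw [Function.update_of_ne hm.ne, hY m (by omega)]
    by_cases h1 : Y (n + 1) = x n + 1
    · exact Or.inl (Or.inl ⟨h1 ▸ key, hE⟩)
    by_cases h2 : Y (n + 1) = x n - 1
    · exact Or.inl (Or.inr ⟨h2 ▸ key, hE⟩)
    exact Or.inr (mem_iUnion.2 ⟨⟨Y (n + 1), h1, h2⟩, key⟩)
  calc P.real (pathCylinder x n ∩ E) ≤ _ := measureReal_mono hsub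
    _ ≤ _ + P.real N := measureReal_union_le _ _
    _ ≤ _ := by
      rw [show P.real N = 0 by simp [Measure.real, hN], add_zero]
      exact measureReal_union_le _ _

/-- A potential `V` that is superharmonic in `(a, b)` and at least `1` at those endpoints
that lie in `S`, corrected by a quadratic term which controls the exit time from `(a, b)`,
bounds the conditional probability of remaining in `S` for `m` steps. -/
lemma real_stay_le_add (hP : IsERWLaw ω x0 P) (hω : IsCookieEnv ω) {a b : ℤ} {S : Set ℤ}
    {V : (ℕ → ℤ) → ℕ → ℝ}
    (hV0 : ∀ x n, a ≤ x n → x n ≤ b → 0 ≤ V x n)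
    (hV1 : ∀ x n, x n = a ∨ x n = b → x n ∈ S → 1 ≤ V x n)
    (hV : ∀ x n, a < x n → x n < b →
      ω (x n) (prevVisits x n) * V (Function.update x (n + 1) (x n + 1)) (n + 1)
        + (1 - ω (x n) (prevVisits x n)) * V (Function.update x (n + 1) (x n - 1)) (n + 1)
        ≤ V x n)
    {M : ℕ} (hM : 0 < M) (m : ℕ) (hm : m ≤ M) (x : ℕ → ℤ) (n : ℕ)
    (ha : a ≤ x n) (hb : x n ≤ b) :
    P.real (pathCylinder x n ∩ {Y | ∀ j ≤ m, Y (n + j) ∈ S})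
      ≤ (V x n + (((b : ℝ) - a) ^ 2 - ((x n : ℝ) - a) ^ 2 + M - m) * (M : ℝ)⁻¹)
        * cylProb ω x0 x n := by
  have := hP.1
  have hM' : (0 : ℝ) < M := by exact_mod_cast hM
  have hr : (0 : ℝ) ≤ (M : ℝ)⁻¹ := by positivity
  have hMr : (M : ℝ) * (M : ℝ)⁻¹ = 1 := mul_inv_cancel₀ hM'.ne'
  generalize (M : ℝ)⁻¹ = r at *
  have hsq : ∀ z : ℤ, a ≤ z → z ≤ b → 0 ≤ ((b : ℝ) - a) ^ 2 - ((z : ℝ) - a) ^ 2 := by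
    intro z h1 h2
    have h1' : (a : ℝ) ≤ z := by exact_mod_cast h1
    have h2' : (z : ℝ) ≤ b := by exact_mod_cast h2
    nlinarith
  have hle : ∀ (x : ℕ → ℤ) (n : ℕ) (E : Set (ℕ → ℤ)) (w : ℝ), 1 ≤ w →
      P.real (pathCylinder x n ∩ E) ≤ w * cylProb ω x0 x n := by
    intro x n E w hw
    calc P.real (pathCylinder x n ∩ E) ≤ P.real (pathCylinder x n) :=
          measureReal_mono inter_subset_left
      _ = cylProb ω x0 x n := hP.real_pathCylinder hω x n
      _ ≤ w * cylProb ω x0 x n := le_mul_of_one_le_left (cylProb_nonneg hω x0 x n) hw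
  induction m generalizing x n with
  | zero =>
    by_cases hS : x n ∈ S
    · refine hle x n _ _ ?_
      rw [Nat.cast_zero]
      nlinarith [hV0 x n ha hb, mul_nonneg (hsq (x n) ha hb) hr]
    · have : pathCylinder x n ∩ {Y | ∀ j ≤ 0, Y (n + j) ∈ S} = ∅ := by
        ext Y
        simp only [mem_inter_iff, mem_ofPred_eq, mem_empty_iff_false, iff_false, not_and]
        intro hY h
        exact hS (hY n le_rfl ▸ h 0 le_rfl)
      rw [this, measureReal_empty]
      refine mul_nonneg ?_ (cylProb_nonneg hω x0 x n)
      rw [Nat.cast_zero]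
      nlinarith [hV0 x n ha hb, mul_nonneg (hsq (x n) ha hb) hr]
  | succ m ih =>
    have hmM : ((m + 1 : ℕ) : ℝ) ≤ M := by exact_mod_cast hm
    have hQ : 0 ≤ (((b : ℝ) - a) ^ 2 - ((x n : ℝ) - a) ^ 2 + M - (m + 1 : ℕ)) * r :=
      mul_nonneg (by linarith [hsq (x n) ha hb]) hr
    by_cases hS : x n ∈ S
    · by_cases hab : x n = a ∨ x n = b
      · exact hle x n _ _ (by linarith [hV1 x n hab hS])
      push Not at hab
      have ha' : a < x n := lt_of_le_of_ne ha (Ne.symm hab.1)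
      have hb' : x n < b := lt_of_le_of_ne hb hab.2
      have hstep : ∀ z : ℤ, a ≤ z → z ≤ b →
          P.real (pathCylinder (Function.update x (n + 1) z) (n + 1)
              ∩ {Y | ∀ j ≤ m + 1, Y (n + j) ∈ S})
            ≤ (V (Function.update x (n + 1) z) (n + 1)
                + (((b : ℝ) - a) ^ 2 - ((z : ℝ) - a) ^ 2 + M - m) * r)
              * (cylProb ω x0 x n * stepProb ω (Function.update x (n + 1) z) n) := by
        intro z hz1 hz2
        have h := ih (by omega) (Function.update x (n + 1) z) (n + 1)
          (by simpa using hz1) (by simpa using hz2)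
        rw [cylProb_update] at h
        simp only [Function.update_self] at h
        refine le_trans (measureReal_mono (inter_subset_inter_right _ ?_)) h
        intro Y hY j hj
        have := hY (j + 1) (by omega)
        rwa [show n + (j + 1) = n + 1 + j by ring] at this
      have h1 := hstep (x n + 1) (by omega) (by omega)
      have h2 := hstep (x n - 1) (by omega) (by omega)
      rw [stepProb_update, if_pos rfl] at h1
      rw [stepProb_update, if_neg (by omega), if_pos rfl] at h2
      refine (hP.real_pathCylinder_inter_le x n _).trans ((add_le_add h1 h2).trans ?_)
      have hc := cylProb_nonneg hω x0 x n
      have hp := hω (x n) (prevVisits x n)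
      have hVx := hV x n ha' hb'
      set p := ω (x n) (prevVisits x n)
      set c := cylProb ω x0 x n
      set V₁ := V (Function.update x (n + 1) (x n + 1)) (n + 1)
      set V₂ := V (Function.update x (n + 1) (x n - 1)) (n + 1)
      have hd : (0 : ℝ) ≤ (x n : ℝ) - a := by
        have : (a : ℝ) ≤ x n := by exact_mod_cast ha
        linarith
      have hq : 0 ≤ (2 * p - 1) * ((x n : ℝ) - a) * r :=
        mul_nonneg (mul_nonneg (by linarith [hp.1]) hd) hr
      push_cast
      rw [show ∀ A B : ℝ, A * (c * p) + B * (c * (1 - p)) = (p * A + (1 - p) * B) * c by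
        intros; ring]
      refine mul_le_mul_of_nonneg_right ?_ hc
      nlinarith
    · have : pathCylinder x n ∩ {Y | ∀ j ≤ m + 1, Y (n + j) ∈ S} = ∅ := by
        ext Y
        simp only [mem_inter_iff, mem_ofPred_eq, mem_empty_iff_false, iff_false, not_and]
        intro hY h
        exact hS (hY n le_rfl ▸ h 0 (Nat.zero_le _))
      rw [this, measureReal_empty]
      exact mul_nonneg (by linarith [hV0 x n ha hb]) (cylProb_nonneg hω x0 x n)

/-- A potential that is superharmonic in `(a, b)` and at least `1` at the endpoints lying
in `S` bounds the conditional probability of remaining in `S` forever. -/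
lemma real_stay_le (hP : IsERWLaw ω x0 P) (hω : IsCookieEnv ω) {a b : ℤ} {S : Set ℤ}
    {V : (ℕ → ℤ) → ℕ → ℝ}
    (hV0 : ∀ x n, a ≤ x n → x n ≤ b → 0 ≤ V x n)
    (hV1 : ∀ x n, x n = a ∨ x n = b → x n ∈ S → 1 ≤ V x n)
    (hV : ∀ x n, a < x n → x n < b →
      ω (x n) (prevVisits x n) * V (Function.update x (n + 1) (x n + 1)) (n + 1)
        + (1 - ω (x n) (prevVisits x n)) * V (Function.update x (n + 1) (x n - 1)) (n + 1)
        ≤ V x n)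
    (x : ℕ → ℤ) (n : ℕ) (ha : a ≤ x n) (hb : x n ≤ b) :
    P.real (pathCylinder x n ∩ {Y | ∀ k ≥ n, Y k ∈ S}) ≤ V x n * cylProb ω x0 x n := by
  have := hP.1
  have hlim : Tendsto (fun M : ℕ => (V x n + (((b : ℝ) - a) ^ 2 - ((x n : ℝ) - a) ^ 2)
      * (M : ℝ)⁻¹) * cylProb ω x0 x n) atTop
      (𝓝 ((V x n + (((b : ℝ) - a) ^ 2 - ((x n : ℝ) - a) ^ 2) * 0) * cylProb ω x0 x n)) :=
    ((tendsto_natCast_atTop_atTop.inv_tendsto_atTop.const_mul _).const_add _).mul_const _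
  rw [mul_zero, add_zero] at hlim
  refine ge_of_tendsto hlim ?_
  filter_upwards [eventually_gt_atTop 0] with M hM
  have h := hP.real_stay_le_add hω hV0 hV1 hV hM M le_rfl x n ha hb
  rw [add_sub_cancel_right] at h
  refine le_trans (measureReal_mono (inter_subset_inter_right _ ?_)) h
  exact fun Y hY j _ => hY (n + j) (Nat.le_add_right n j)

/-- The walk comes back from the left: its drift is nonnegative. -/
lemma real_ne_zero_of_neg (hP : IsERWLaw ω x0 P) (hω : IsCookieEnv ω)
    (x : ℕ → ℤ) (n : ℕ) (hx : x n < 0) {L : ℕ} (hL : -(L : ℤ) ≤ x n) :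
    P.real (pathCylinder x n ∩ {Y | ∀ k ≥ n, Y k ∈ ({0}ᶜ : Set ℤ)})
      ≤ -(x n : ℝ) / L * cylProb ω x0 x n := by
  have hL0 : (0 : ℝ) < L := by
    have : 0 < L := by omega
    exact_mod_cast this
  refine hP.real_stay_le hω (a := -(L : ℤ)) (b := 0) (V := fun x n => -(x n : ℝ) / L)
    ?_ ?_ ?_ x n hL hx.le
  · intro x n _ h
    have : (x n : ℝ) ≤ 0 := by exact_mod_cast h
    exact div_nonneg (by linarith) hL0.le
  · rintro x n (h | h) hS
    · simp [h, hL0.ne']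
    · exact absurd h hS
  · intro x n _ _
    have hp := hω (x n) (prevVisits x n)
    simp only [Function.update_self]
    push_cast
    rw [mul_div_assoc', mul_div_assoc', ← add_div]
    refine div_le_div_of_nonneg_right ?_ hL0.le
    nlinarith [hp.1]

end IsERWLaw

/-- The drift stored at the sites `0, …, K - 1` that the path `x` has not consumed
before time `n`. -/
def remainingDrift (ω : CEnv) (K : ℕ) (x : ℕ → ℤ) (n : ℕ) : ℝ :=
  ∑ s ∈ Finset.range K, ∑' i : ℕ, (2 * ω (s : ℤ) (i + visitCount x n s) - 1)

lemma remainingDrift_nonneg {ω : CEnv} (hω : IsCookieEnv ω) (K : ℕ) (x : ℕ → ℤ) (n : ℕ) :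
    0 ≤ remainingDrift ω K x n :=
  Finset.sum_nonneg fun s _ => tsum_nonneg fun i => by
    linarith [(hω s (i + visitCount x n s)).1]

lemma summable_of_cookieDrift_ne_top {ω : CEnv} (hω : IsCookieEnv ω) {s : ℤ}
    (h : cookieDrift ω s ≠ ∞) : Summable fun i => 2 * ω s i - 1 := by
  refine (ENNReal.summable_toReal h).congr fun i => ?_
  exact ENNReal.toReal_ofReal (by linarith [(hω s i).1])

lemma remainingDrift_update {ω : CEnv} (hω : IsCookieEnv ω) {K : ℕ}
    (hK : ∀ s < K, cookieDrift ω (s : ℤ) ≠ ∞) (x : ℕ → ℤ) (n : ℕ) (z : ℤ)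
    (h0 : 0 ≤ x n) (h1 : x n < K) :
    remainingDrift ω K (Function.update x (n + 1) z) (n + 1)
      = remainingDrift ω K x n - (2 * ω (x n) (prevVisits x n) - 1) := by
  obtain ⟨k, hk⟩ := Int.eq_ofNat_of_zero_le h0
  have hkK : k ∈ Finset.range K := Finset.mem_range.2 (by omega)
  unfold remainingDrift
  rw [← Finset.add_sum_erase _ _ hkK, ← Finset.add_sum_erase _ _ hkK]
  have hrest : ∑ s ∈ (Finset.range K).erase k, ∑' i : ℕ,
        (2 * ω (s : ℤ) (i + visitCount (Function.update x (n + 1) z) (n + 1) s) - 1)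
      = ∑ s ∈ (Finset.range K).erase k, ∑' i : ℕ,
        (2 * ω (s : ℤ) (i + visitCount x n s) - 1) := by
    refine Finset.sum_congr rfl fun s hs => ?_
    have : x n ≠ (s : ℤ) := by
      have := Finset.ne_of_mem_erase hs
      omega
    rw [visitCount_update, if_neg this, add_zero]
  have hs : Summable fun i => 2 * ω (k : ℤ) (i + visitCount x n k) - 1 :=
    (summable_nat_add_iff (f := fun i => 2 * ω (k : ℤ) i - 1) _).2
      (summable_of_cookieDrift_ne_top hω (hK k (Finset.mem_range.1 hkK)))
  have hpv : prevVisits x n = visitCount x n k := by rw [← hk]; rfl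
  rw [hrest, visitCount_update, if_pos hk, hs.tsum_eq_zero_add, hpv, hk, zero_add]
  simp only [add_assoc, add_comm 1]
  ring

lemma remainingDrift_le {ω : CEnv} (hω : IsCookieEnv ω) {K : ℕ}
    (hK : ∀ s < K, cookieDrift ω (s : ℤ) ≠ ∞) (x : ℕ → ℤ) (n : ℕ) :
    remainingDrift ω K x n ≤ (∑ s ∈ Finset.range K, cookieDrift ω (s : ℤ)).toReal := by
  rw [ENNReal.toReal_sum fun s hs => hK s (Finset.mem_range.1 hs)]
  refine Finset.sum_le_sum fun s hs => ?_
  have hsum := summable_of_cookieDrift_ne_top hω (hK s (Finset.mem_range.1 hs))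
  have heq : (cookieDrift ω (s : ℤ)).toReal = ∑' i, (2 * ω (s : ℤ) i - 1) := by
    rw [cookieDrift, ENNReal.tsum_toReal_eq fun i => ENNReal.ofReal_ne_top]
    exact tsum_congr fun i => ENNReal.toReal_ofReal (by linarith [(hω s i).1])
  rw [heq, ← hsum.sum_add_tsum_nat_add (visitCount x n s)]
  exact le_add_of_nonneg_left (Finset.sum_nonneg fun i _ => by linarith [(hω s i).1])

namespace IsERWLaw

variable {ω : CEnv} {x0 : ℤ} {P : Measure (ℕ → ℤ)}

lemma real_ne_zero_of_pos (hP : IsERWLaw ω x0 P) (hω : IsCookieEnv ω) {K : ℕ}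
    (hK : ∀ s < K, cookieDrift ω (s : ℤ) ≠ ∞)
    (x : ℕ → ℤ) (n : ℕ) (hx : 0 < x n) (hxK : x n ≤ K) :
    P.real (pathCylinder x n ∩ {Y | ∀ k ≥ n, Y k ∈ ({0}ᶜ : Set ℤ)})
      ≤ (x n + remainingDrift ω K x n) / K * cylProb ω x0 x n := by
  have hK0 : (0 : ℝ) < K := by
    have : 0 < K := by omega
    exact_mod_cast this
  refine hP.real_stay_le hω (a := 0) (b := K)
    (V := fun x n => (x n + remainingDrift ω K x n) / K) ?_ ?_ ?_ x n hx.le hxK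
  · intro x n h _
    have : (0 : ℝ) ≤ x n := by exact_mod_cast h
    exact div_nonneg (add_nonneg this (remainingDrift_nonneg hω K x n)) hK0.le
  · rintro x n (h | h) hS
    · exact absurd h hS
    · rw [le_div_iff₀ hK0, h]
      push_cast
      linarith [remainingDrift_nonneg hω K x n]
  · intro x n h0 h1
    simp only [Function.update_self, remainingDrift_update hω hK x n _ h0.le h1]
    push_cast
    rw [mul_div_assoc', mul_div_assoc', ← add_div]
    refine div_le_div_of_nonneg_right (le_of_eq ?_) hK0.le
    ring

/-- If the conditional probability of avoiding `S` forever is bounded away from `1`,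
uniformly over all histories, then a.s. the path does not eventually avoid `S`. -/
lemma measure_eventually_eq_zero (hP : IsERWLaw ω x0 P) {S : Set ℤ} {c : ℝ≥0∞} (hc : c < 1)
    (h : ∀ x n, P (pathCylinder x n ∩ {Y | ∀ k ≥ n, Y k ∈ S}) ≤ c * P (pathCylinder x n))
    (N : ℕ) : P {Y | ∀ k ≥ N, Y k ∈ S} = 0 := by
  have := hP.1
  set A : Set (ℕ → ℤ) := {Y | ∀ k ≥ N, Y k ∈ S}
  have hmeas : ∀ (s : Set ℤ) (k : ℕ), MeasurableSet {Y : ℕ → ℤ | Y k ∈ s} := fun s k =>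
    measurable_pi_apply k (MeasurableSet.of_discrete (s := s))
  set B : ℕ → Set (ℕ → ℤ) := fun n => {Y | ∀ j ≤ n, Y (N + j) ∈ S}
  have hB : ∀ n, MeasurableSet (B n) := fun n => by
    have : B n = ⋂ j, ⋂ _ : j ≤ n, {Y : ℕ → ℤ | Y (N + j) ∈ S} := by
      ext; simp [B]
    rw [this]
    exact MeasurableSet.iInter fun j => MeasurableSet.iInter fun _ => hmeas S _
  have hAB : A = ⋂ n, B n := by
    ext Y
    simp only [A, B, mem_ofPred_eq, mem_iInter]
    refine ⟨fun h n j _ => h _ (Nat.le_add_right N j), fun h k hk => ?_⟩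
    have := h (k - N) (k - N) le_rfl
    rwa [Nat.add_sub_cancel' hk] at this
  have hA : MeasurableSet A := hAB ▸ MeasurableSet.iInter hB
  have hle : ∀ n, P A ≤ c * P (B n) := by
    intro n
    let π : (ℕ → ℤ) → (Fin (N + n + 1) → ℤ) := fun Y i => Y i
    have hπ : Measurable π := measurable_pi_lambda _ fun i => measurable_pi_apply _
    set s : Set (Fin (N + n + 1) → ℤ) := π '' B n
    have hs : π ⁻¹' s = B n := by
      refine Subset.antisymm ?_ (subset_preimage_image π (B n))
      rintro Y ⟨Z, hZ, hZY⟩ j hj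
      have : Z (N + j) = Y (N + j) := congrFun hZY ⟨N + j, by omega⟩
      exact this ▸ hZ j hj
    have hcyl : ∀ Z : ℕ → ℤ, π ⁻¹' {π Z} = pathCylinder Z (N + n) := by
      intro Z
      ext Y
      simp only [π, mem_preimage, mem_singleton_iff, pathCylinder, mem_ofPred_eq, funext_iff]
      exact ⟨fun h m hm => h ⟨m, by omega⟩, fun h i => h i (by omega)⟩
    have hmp : ∀ y ∈ s, MeasurableSet (π ⁻¹' {y}) := fun y _ => hπ (measurableSet_singleton y)
    calc P A = P.restrict A (π ⁻¹' s) := by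
          rw [hs, Measure.restrict_apply (hB n), inter_eq_right.2 (hAB ▸ iInter_subset B n)]
      _ = ∑' y : s, P.restrict A (π ⁻¹' {(y : Fin (N + n + 1) → ℤ)}) :=
          (tsum_measure_preimage_singleton s.to_countable hmp).symm
      _ ≤ ∑' y : s, c * P (π ⁻¹' {(y : Fin (N + n + 1) → ℤ)}) := by
          refine ENNReal.tsum_le_tsum fun y => ?_
          obtain ⟨Z, -, hZ⟩ := y.2
          rw [Measure.restrict_apply (hmp y y.2), ← hZ, hcyl]
          refine le_trans (measure_mono (inter_subset_inter_right _ ?_)) (h Z (N + n))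
          exact fun Y hY k hk => hY k (by omega)
      _ = c * P (B n) := by
          rw [ENNReal.tsum_mul_left, tsum_measure_preimage_singleton s.to_countable hmp, hs]
  have hanti : Antitone B := fun m n hmn Y hY j hj => hY j (hj.trans hmn)
  have hlim : Tendsto (fun n => c * P (B n)) atTop (𝓝 (c * P A)) := by
    rw [hAB]
    exact ENNReal.Tendsto.const_mul (tendsto_measure_iInter_atTop
      (fun n => (hB n).nullMeasurableSet) hanti ⟨0, measure_ne_top P _⟩)
      (Or.inr (hc.trans ENNReal.one_lt_top).ne)
  have hfin : P A ≤ c * P A := ge_of_tendsto' hlim hle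
  by_contra hne
  have : c * P A < 1 * P A :=
    (ENNReal.mul_lt_mul_iff_left hne (measure_ne_top P A)).2 hc
  rw [one_mul] at this
  exact this.not_ge hfin

end IsERWLaw

/-- Corollary 9. If `liminf_{K→∞} (1/K) ∑_{x=0}^{K−1} δ^x(ω) < 1`
then `0` is `ω`-recurrent. -/
theorem erw_recurrence_criterion (ω : CEnv) (hω : IsCookieEnv ω)
    (hdrift : Filter.atTop.liminf
      (fun K : ℕ => (∑ x ∈ Finset.range K, cookieDrift ω (x : ℤ)) / (K : ℝ≥0∞)) < 1)
    (P : ℤ → Measure (ℕ → ℤ)) (hP : ∀ x, IsERWLaw ω x (P x)) :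
    ∀ x, P x (Rset 0) = 1 := by
  intro x0
  have hP0 := hP x0
  generalize P x0 = Q at hP0
  have := hP0.1
  obtain ⟨c, hc0, hlc, hc1⟩ : ∃ c : ℝ, 0 ≤ c ∧ _ ∧ ENNReal.ofReal c < 1 :=
    ENNReal.lt_iff_exists_real_btwn.1 hdrift
  have hc1' : c < 1 := by simpa using hc1
  have hfreq := frequently_lt_of_liminf_lt (by isBoundedDefault) hlc
  have hlarge : ∀ L : ℕ, ∃ K : ℕ, L < K ∧
      (∀ s < K, cookieDrift ω (s : ℤ) ≠ ∞) ∧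
      (∑ s ∈ Finset.range K, cookieDrift ω (s : ℤ)).toReal ≤ c * K := by
    intro L
    obtain ⟨K, hK, hlt⟩ := (hfreq.and_eventually (eventually_gt_atTop L)).exists
    have hK0 : (K : ℝ≥0∞) ≠ 0 := by
      have : K ≠ 0 := by omega
      exact_mod_cast this
    have hle : ∑ s ∈ Finset.range K, cookieDrift ω (s : ℤ) ≤ ENNReal.ofReal c * K :=
      (ENNReal.div_le_iff hK0 (ENNReal.natCast_ne_top K)).1 hK.le
    have htop : ENNReal.ofReal c * K ≠ ∞ :=
      ENNReal.mul_ne_top ENNReal.ofReal_ne_top (ENNReal.natCast_ne_top K)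
    refine ⟨K, hlt, fun s hs => ?_, ?_⟩
    · exact ne_top_of_le_ne_top htop
        ((Finset.single_le_sum (f := fun s : ℕ => cookieDrift ω (s : ℤ))
          (fun _ _ => zero_le) (Finset.mem_range.2 hs)).trans hle)
    · have := ENNReal.toReal_mono htop hle
      rwa [ENNReal.toReal_mul, ENNReal.toReal_ofReal hc0, ENNReal.toReal_natCast] at this
  obtain ⟨d, hcd, hd1⟩ := exists_between hc1'
  have hd0 : 0 < d := hc0.trans_lt hcd
  have hreal : ∀ x n, Q.real (pathCylinder x n ∩ {Y | ∀ k ≥ n, Y k ∈ ({0}ᶜ : Set ℤ)})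
      ≤ d * cylProb ω x0 x n := by
    intro x n
    have hcyl := cylProb_nonneg hω x0 x n
    rcases lt_trichotomy (x n) 0 with hx | hx | hx
    · obtain ⟨L, hL⟩ := exists_nat_gt (-(x n : ℝ) / d)
      have hx' : (x n : ℝ) < 0 := by exact_mod_cast hx
      have hL1 : -(x n : ℝ) < L * d := (div_lt_iff₀ hd0).1 hL
      have hL0 : (0 : ℝ) < L := lt_trans (div_pos (by linarith) hd0) hL
      have hLx : -(L : ℤ) ≤ x n := by
        have : -(L : ℝ) ≤ x n := by nlinarith
        exact_mod_cast this
      refine (hP0.real_ne_zero_of_neg hω x n hx hLx).trans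
        (mul_le_mul_of_nonneg_right ?_ hcyl)
      rw [div_le_iff₀ hL0]
      linarith
    · have : pathCylinder x n ∩ {Y | ∀ k ≥ n, Y k ∈ ({0}ᶜ : Set ℤ)} = ∅ := by
        ext Y
        simp only [mem_inter_iff, mem_ofPred_eq, mem_empty_iff_false, iff_false, not_and]
        intro hY h
        exact h n le_rfl ((hY n le_rfl).trans hx)
      rw [this, measureReal_empty]
      positivity
    · obtain ⟨L, hL⟩ := exists_nat_gt ((x n : ℝ) / (d - c))
      obtain ⟨K, hLK, hfin, hsum⟩ := hlarge (max L (x n).toNat)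
      have hxK : x n ≤ K := by omega
      have hLK' : (L : ℝ) < K := by exact_mod_cast (le_max_left _ _).trans_lt hLK
      have hK0 : (0 : ℝ) < K := lt_of_le_of_lt (Nat.cast_nonneg L) hLK'
      have hxL : (x n : ℝ) < L * (d - c) := (div_lt_iff₀ (by linarith)).1 hL
      refine (hP0.real_ne_zero_of_pos hω hfin x n hx hxK).trans
        (mul_le_mul_of_nonneg_right ?_ hcyl)
      rw [div_le_iff₀ hK0]
      have := remainingDrift_le hω hfin x n
      nlinarith
  have hcompl : (Rset 0)ᶜ = ⋃ N, {Y : ℕ → ℤ | ∀ k ≥ N, Y k ∈ ({0}ᶜ : Set ℤ)} := by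
    ext Y
    simp [Rset]
  have hnull : Q (Rset 0)ᶜ = 0 := by
    rw [hcompl]
    refine measure_iUnion_null fun N => hP0.measure_eventually_eq_zero
      (c := ENNReal.ofReal d) (by simpa using hd1) (fun x n => ?_) N
    rw [← ofReal_measureReal (μ := Q), ← ofReal_measureReal (s := pathCylinder x n),
      ← ENNReal.ofReal_mul hd0.le, hP0.real_pathCylinder hω]
    exact ENNReal.ofReal_le_ofReal (hreal x n)
  have huniv : Rset 0 =ᵐ[Q] univ := eventuallyEq_univ.2 hnull
  rw [measure_congr huniv, measure_univ]

end
end
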